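/- Let n ≥ 2, p < 1, and 0 < τ1 < τ2. Suppose f : S^{n-1} → ℝ satisfies τ1 < f(u) < τ2 for all u ∈ S^{n-1}, and K ∈ K_0^n is a solution of the L_p Minkowski problem dS_{K,p} = f dH^{n-1}. If o ∈ ∂K and o is a smooth point of K, then K is smooth. -/

import Mathlib

open MeasureTheory Set
open scoped ENNReal NNReal RealInnerProductSpace

noncomputable section

/-- Support function of a set `K`. -/
def suppFn {n : ℕ} (K : Set (EuclideanSpace ℝ (Fin n))) (u : EuclideanSpace ℝ (Fin n)) : ℝ :=
  sSup ((fun y => ⟪u, y⟫) '' K)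

/-- Face of `K` with outer normal `u`. -/
def face {n : ℕ} (K : Set (EuclideanSpace ℝ (Fin n))) (u : EuclideanSpace ℝ (Fin n)) :
    Set (EuclideanSpace ℝ (Fin n)) :=
  {z ∈ K | ⟪z, u⟫ = suppFn K u}

/-- Normal cone of `K` at `z`. -/
def normalCone {n : ℕ} (K : Set (EuclideanSpace ℝ (Fin n))) (z : EuclideanSpace ℝ (Fin n)) :
    Set (EuclideanSpace ℝ (Fin n)) :=
  {u | ∀ y ∈ K, ⟪u, y⟫ ≤ ⟪u, z⟫}

/-- The unit sphere `S^{n-1}` in `ℝ^n`. -/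
def unitSphere (n : ℕ) : Set (EuclideanSpace ℝ (Fin n)) :=
  Metric.sphere (0 : EuclideanSpace ℝ (Fin n)) 1

/-- Surface area measure of `K` evaluated on `ω`:
`S_K(ω) = H^{n-1}(⋃_{u ∈ ω} F(K,u))`. -/
def surfMeas {n : ℕ} (K : Set (EuclideanSpace ℝ (Fin n)))
    (ω : Set (EuclideanSpace ℝ (Fin n))) : ℝ≥0∞ :=
  μH[(n : ℝ) - 1] (⋃ u ∈ ω, face K u)

/-- `K ∈ 𝒦₀ⁿ`: compact convex with nonempty interior, containing the origin. -/
def IsConvexBody0 {n : ℕ} (K : Set (EuclideanSpace ℝ (Fin n))) : Prop :=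
  IsCompact K ∧ Convex ℝ K ∧ (interior K).Nonempty ∧ (0 : EuclideanSpace ℝ (Fin n)) ∈ K

/-- `K` is a solution of the `L_p` Minkowski problem `dS_{K,p} = f dH^{n-1}`. -/
def IsLpSolution {n : ℕ} (p : ℝ) (f : EuclideanSpace ℝ (Fin n) → ℝ)
    (K : Set (EuclideanSpace ℝ (Fin n))) : Prop :=
  μH[(n : ℝ) - 1] {u ∈ unitSphere n | suppFn K u = 0} = 0 ∧
  ∀ ω : Set (EuclideanSpace ℝ (Fin n)), MeasurableSet ω →
    ω ⊆ {u ∈ unitSphere n | 0 < suppFn K u} →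
    surfMeas K ω
      = ∫⁻ u in ω, ENNReal.ofReal ((n : ℝ) * f u * suppFn K u ^ (p - 1)) ∂μH[(n : ℝ) - 1]

/-- `x` is a smooth boundary point: the normal cone spans a one-dimensional space. -/
def IsSmoothPt {n : ℕ} (K : Set (EuclideanSpace ℝ (Fin n)))
    (x : EuclideanSpace ℝ (Fin n)) : Prop :=
  Module.finrank ℝ (Submodule.span ℝ (normalCone K x)) = 1

/-- `K` is smooth: every boundary point is a smooth point. -/
def IsSmoothBody {n : ℕ} (K : Set (EuclideanSpace ℝ (Fin n))) : Prop :=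
  ∀ x ∈ frontier K, IsSmoothPt K x

/-- Subgradient of `v` at `x` relative to the domain `Ω`. -/
def subgrad {n : ℕ} (Ω : Set (EuclideanSpace ℝ (Fin n))) (v : EuclideanSpace ℝ (Fin n) → ℝ)
    (x : EuclideanSpace ℝ (Fin n)) : Set (EuclideanSpace ℝ (Fin n)) :=
  {z | ∀ y ∈ Ω, v x + ⟪z, y - x⟫ ≤ v y}

/-- Monge–Ampère measure of `v` (relative to domain `Ω`) evaluated on `ω`. -/
def maMeasure {n : ℕ} (Ω : Set (EuclideanSpace ℝ (Fin n))) (v : EuclideanSpace ℝ (Fin n) → ℝ)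
    (ω : Set (EuclideanSpace ℝ (Fin n))) : ℝ≥0∞ :=
  μH[(n : ℝ)] (⋃ x ∈ ω, subgrad Ω v x)

/-- Hessian matrix of `v : ℝ^n → ℝ` at `x`. -/
def hessMatrix {n : ℕ} (v : EuclideanSpace ℝ (Fin n) → ℝ) (x : EuclideanSpace ℝ (Fin n)) :
    Matrix (Fin n) (Fin n) ℝ :=
  Matrix.of fun i j =>
    fderiv ℝ (fun y => fderiv ℝ v y (EuclideanSpace.single j 1)) x (EuclideanSpace.single i 1)

section Abstract
open scoped Pointwise
set_option linter.unusedSectionVars false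

variable {W : Type*} [NormedAddCommGroup W] [InnerProductSpace ℝ W] [FiniteDimensional ℝ W]
  [MeasurableSpace W] [BorelSpace W]

/-- total subgradient image -/
def subd (w : W → ℝ) (B : Set W) : Set W := {q | ∃ z ∈ B, ∀ y, w z + ⟪q, y - z⟫ ≤ w y}

/-- polar body with respect to a centre -/
def polarAt (D : Set W) (z : W) : Set W := {q | ∀ y ∈ D, ⟪q, y - z⟫ ≤ 1}

lemma isClosed_polarAt (D : Set W) (z : W) : IsClosed (polarAt D z) := by
  have : polarAt D z = ⋂ y ∈ D, {q | ⟪q, y - z⟫ ≤ 1} := by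
    ext q; simp [polarAt]
  rw [this]
  refine isClosed_biInter fun y _ => isClosed_le (by fun_prop) continuous_const

lemma comb_mem {D : Set W} (hc : Convex ℝ D) {a b : W} (ha : a ∈ D) (hb : b ∈ D)
    {s t : ℝ} (hs : 0 ≤ s) (ht : 0 ≤ t) : ∃ y ∈ D, s • a + t • b = (s + t) • y := by
  rcases eq_or_lt_of_le (add_nonneg hs ht) with h | h
  · have h1 : s = 0 := by linarith
    have h2 : t = 0 := by linarith
    exact ⟨a, ha, by simp [h1, h2]⟩
  · refine ⟨(s/(s+t)) • a + (t/(s+t)) • b, hc ha hb (by positivity) (by positivity)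
      (by field_simp), ?_⟩
    rw [smul_add, smul_smul, smul_smul, mul_div_cancel₀ _ h.ne', mul_div_cancel₀ _ h.ne']

lemma sum_comb {D : Set W} (hc : Convex ℝ D) {d0 : W} (h0 : d0 ∈ D) {c : ℝ} (hc0 : 0 ≤ c)
    (S : Finset D) : ∃ y ∈ D, (∑ i ∈ S, (i : W)) + c • d0 = ((S.card : ℝ) + c) • y := by
  classical
  induction S using Finset.induction_on with
  | empty => exact ⟨d0, h0, by simp⟩
  | insert a S ha ih =>
    obtain ⟨y, hy, h⟩ := ih
    obtain ⟨y', hy', h'⟩ := comb_mem hc a.2 hy zero_le_one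
      (show (0:ℝ) ≤ (S.card : ℝ) + c by positivity)
    refine ⟨y', hy', ?_⟩
    rw [Finset.sum_insert ha, Finset.card_insert_of_notMem ha, add_assoc, h]
    rw [one_smul] at h'
    rw [h']; push_cast; congr 1; ring

/-- Quasi-centre by Helly. -/
lemma exists_quasi_center {D : Set W} (hD : IsCompact D) (hc : Convex ℝ D) (hne : D.Nonempty) :
    ∃ z ∈ D, ∀ d ∈ D, ∃ y ∈ D,
      ((Module.finrank ℝ W : ℝ) + 1) • z = (Module.finrank ℝ W : ℝ) • y + d := by
  classical
  set m := Module.finrank ℝ W with hm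
  have hm1 : (0:ℝ) < (m:ℝ) + 1 := by positivity
  obtain ⟨d0, hd0⟩ := hne
  let F : D → Set W := fun d => {z | ∃ y ∈ D, ((m:ℝ)+1) • z = (m:ℝ) • y + d}
  have hcv : ∀ i, Convex ℝ (F i) := by
    rintro i z ⟨y, hy, h⟩ z' ⟨y', hy', h'⟩ a b ha hb hab
    refine ⟨a • y + b • y', hc hy hy' ha hb hab, ?_⟩
    calc ((m:ℝ)+1) • (a • z + b • z') = a • (((m:ℝ)+1) • z) + b • (((m:ℝ)+1) • z') := by module
      _ = (m:ℝ) • (a • y + b • y') + (a + b) • (i:W) := by rw [h, h']; module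
      _ = _ := by rw [hab, one_smul]
  have hcp : ∀ i, IsCompact (F i) := by
    intro i
    have : F i = (fun y : W => ((m:ℝ)+1)⁻¹ • ((m:ℝ) • y + (i : W))) '' D := by
      ext z
      constructor
      · rintro ⟨y, hy, h⟩
        exact ⟨y, hy, by simp only [← h, smul_smul, inv_mul_cancel₀ hm1.ne', one_smul]⟩
      · rintro ⟨y, hy, rfl⟩
        exact ⟨y, hy, by rw [smul_smul, mul_inv_cancel₀ hm1.ne', one_smul]⟩
    rw [this]
    exact hD.image (by fun_prop)
  have hint : ∀ I : Finset D, I.card ≤ m + 1 → (⋂ i ∈ I, F i).Nonempty := by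
    intro I hI
    have hI' : (I.card : ℝ) ≤ m + 1 := by exact_mod_cast hI
    refine ⟨((m:ℝ)+1)⁻¹ • ((∑ i ∈ I, (i : W)) + ((m:ℝ) + 1 - I.card) • d0), ?_⟩
    simp only [mem_iInter]
    intro j hj
    obtain ⟨y, hy, h⟩ := sum_comb hc hd0 (show (0:ℝ) ≤ (m:ℝ) + 1 - I.card by linarith) (I.erase j)
    refine ⟨y, hy, ?_⟩
    rw [smul_smul, mul_inv_cancel₀ hm1.ne', one_smul, ← Finset.add_sum_erase I _ hj, add_assoc, h,
      Finset.cast_card_erase_of_mem hj, add_comm]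
    congr 2; ring
  obtain ⟨z, hz⟩ := Convex.helly_theorem_compact' (𝕜 := ℝ) hcv hcp hint
  simp only [mem_iInter] at hz
  refine ⟨z, ?_, fun d hd => hz ⟨d, hd⟩⟩
  obtain ⟨y, hy, h⟩ := hz ⟨d0, hd0⟩
  obtain ⟨y', hy', h'⟩ := comb_mem hc hy hd0 (show (0:ℝ) ≤ m by positivity) zero_le_one
  rw [one_smul] at h'
  have : z = y' := smul_right_injective W hm1.ne' (show ((m:ℝ)+1) • z = ((m:ℝ)+1) • y' by
    rw [h]; exact h')
  rwa [this]

lemma ofReal_pow_smul (μ : Measure W) [μ.IsAddHaarMeasure] {r : ℝ} (hr : 0 ≤ r) (s : Set W) :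
    μ (r • s) = ENNReal.ofReal r ^ (Module.finrank ℝ W) * μ s := by
  rw [Measure.addHaar_smul, abs_of_nonneg (by positivity), ENNReal.ofReal_pow hr]

lemma polar_transl (μ : Measure W) [μ.IsAddHaarMeasure] {D : Set W}
    {z0 y1 d' g : W} (hy1 : y1 ∈ D) (hd' : d' ∈ D)
    (hz : ∀ d ∈ D, ∃ y ∈ D,
      ((Module.finrank ℝ W : ℝ) + 1) • z0 = (Module.finrank ℝ W : ℝ) • y + d)
    {η : ℝ} (hη : 0 < η) (hg : ∀ y ∈ D, ⟪g, y - y1⟫ ≤ η) {N : ℕ} (hN : 0 < N)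
    (hgd : 4 * N * η ≤ ⟪g, y1 - d'⟫) :
    (N : ℝ≥0∞) * μ (polarAt D z0) ≤
      ENNReal.ofReal (2 * ((Module.finrank ℝ W : ℝ) + 1)) ^ (Module.finrank ℝ W)
        * μ (polarAt D y1) := by
  set m := Module.finrank ℝ W with hm
  set r : ℝ := (2 * ((m : ℝ) + 1))⁻¹ with hr
  have hm0 : (0:ℝ) ≤ m := by positivity
  have hr0 : 0 < r := by positivity
  have hNr : (0:ℝ) < N := by exact_mod_cast hN
  have hlow : ∀ q ∈ polarAt D z0, ∀ d ∈ D, -m ≤ ⟪q, d - z0⟫ := by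
    intro q hq d hd
    obtain ⟨y, hy, h⟩ := hz d hd
    have h1 := hq y hy
    have h2 : d - z0 = - ((m:ℝ) • (y - z0)) := by
      have : d = ((m:ℝ)+1) • z0 - (m:ℝ) • y := by rw [h]; abel
      rw [this]; module
    rw [h2, inner_neg_right, inner_smul_right]
    nlinarith
  let E : W := η⁻¹ • g
  let T : Fin N → Set W := fun j => (fun h => h + (-(((j:ℕ):ℝ) / (2 * N))) • E) ⁻¹' (r • polarAt D z0)
  have hT : ∀ j, T j ⊆ polarAt D y1 := by
    intro j q hq y hy
    obtain ⟨p, hp, hpq⟩ := hq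
    simp only at hpq
    have hqe : q = r • p + (((j:ℕ):ℝ) / (2 * N)) • E := by
      rw [hpq]; module
    have hj : (((j:ℕ):ℝ) / (2 * N)) ≤ 1/2 := by
      rw [div_le_iff₀ (by positivity)]
      have : ((j:ℕ):ℝ) ≤ N := by exact_mod_cast j.2.le
      linarith
    have hj0 : 0 ≤ (((j:ℕ):ℝ) / (2 * N)) := by positivity
    have h1 := hp y hy
    have h2 := hlow p hp y1 hy1
    have h3 : ⟪p, y - y1⟫ ≤ 1 + m := by
      have : y - y1 = (y - z0) - (y1 - z0) := by abel
      rw [this, inner_sub_right]; linarith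
    have h4 : ⟪E, y - y1⟫ ≤ 1 := by
      simp only [E, inner_smul_left, conj_trivial]
      rw [inv_mul_le_iff₀ hη]; simpa using hg y hy
    rw [hqe, inner_add_left, inner_smul_left, inner_smul_left]
    simp only [conj_trivial]
    have h5 : r * ⟪p, y - y1⟫ ≤ 1/2 := by
      calc r * ⟪p, y - y1⟫ ≤ r * (1 + m) := by gcongr
        _ = 1/2 := by rw [hr]; field_simp; ring
    nlinarith
  have hdisj : Pairwise (Function.onFun Disjoint T) := by
    intro i j hij
    rw [Function.onFun, Set.disjoint_left]
    rintro q ⟨p, hp, hpq⟩ ⟨p', hp', hpq'⟩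
    simp only at hpq hpq'
    have key : ∀ (i j : Fin N), i < j → ∀ p ∈ polarAt D z0, ∀ p' ∈ polarAt D z0,
        r • p = q + (-(((i:ℕ):ℝ) / (2 * N))) • E → r • p' = q + (-(((j:ℕ):ℝ) / (2 * N))) • E →
        False := by
      intro i j hij p hp p' hp' h h'
      have e1 : r • (p - p') = ((((j:ℕ):ℝ) - ((i:ℕ):ℝ)) / (2 * N)) • E := by
        rw [smul_sub, h, h', sub_div]; module
      have e2 := congrArg (fun a => ⟪a, y1 - d'⟫) e1
      simp only [inner_smul_left, conj_trivial, inner_sub_left, E] at e2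
      have b1 := hp y1 hy1
      have b2 := hlow p hp d' hd'
      have b3 := hp' d' hd'
      have b4 := hlow p' hp' y1 hy1
      have c1 : y1 - d' = (y1 - z0) - (d' - z0) := by abel
      have c2 : ⟪p, y1 - d'⟫ - ⟪p', y1 - d'⟫ ≤ 2 * (m + 1) := by
        rw [c1, inner_sub_right p, inner_sub_right p']; linarith
      have c3 : r * (⟪p, y1 - d'⟫ - ⟪p', y1 - d'⟫) ≤ 1 := by
        rw [hr, inv_mul_le_iff₀ (by positivity)]; linarith
      have c4 : (1:ℝ) ≤ ((j:ℕ):ℝ) - ((i:ℕ):ℝ) := by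
        have : ((i:ℕ):ℝ) + 1 ≤ ((j:ℕ):ℝ) := by exact_mod_cast hij
        linarith
      have c5 : 4 * (N:ℝ) ≤ η⁻¹ * ⟪g, y1 - d'⟫ := by
        rw [le_inv_mul_iff₀ hη]; linarith
      have c6 : (2:ℝ) ≤ (((j:ℕ):ℝ) - ((i:ℕ):ℝ)) / (2 * N) * (η⁻¹ * ⟪g, y1 - d'⟫) := by
        calc (2:ℝ) = 1 / (2 * N) * (4 * N) := by field_simp; norm_num
          _ ≤ _ := by gcongr
      rw [e2] at c3
      linarith
    rcases lt_or_gt_of_ne hij with h | h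
    · exact key i j h p hp p' hp' hpq hpq'
    · exact key j i h p' hp' p hp hpq' hpq
  have hmeas : ∀ j, MeasurableSet (T j) := by
    intro j
    refine measurableSet_preimage (by fun_prop) ?_
    exact (((isClosed_polarAt D z0).smul_of_ne_zero hr0.ne').measurableSet)
  have hsum : μ (⋃ j, T j) = (N : ℝ≥0∞) * (ENNReal.ofReal r ^ m * μ (polarAt D z0)) := by
    rw [measure_iUnion hdisj hmeas, tsum_fintype]
    simp only [T, measure_preimage_add_right, ofReal_pow_smul μ hr0.le]
    simp [hm]
  have hle : (N : ℝ≥0∞) * (ENNReal.ofReal r ^ m * μ (polarAt D z0)) ≤ μ (polarAt D y1) := by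
    rw [← hsum]; exact measure_mono (iUnion_subset hT)
  calc (N : ℝ≥0∞) * μ (polarAt D z0)
      = ENNReal.ofReal (2 * ((m : ℝ) + 1)) ^ m * ((N : ℝ≥0∞) *
          (ENNReal.ofReal r ^ m * μ (polarAt D z0))) := by
        have : ENNReal.ofReal (2 * ((m : ℝ) + 1)) ^ m * ENNReal.ofReal r ^ m = 1 := by
          rw [← mul_pow, ← ENNReal.ofReal_mul (by positivity), hr, mul_inv_cancel₀ (by positivity)]
          simp
        calc _ = (ENNReal.ofReal (2 * ((m : ℝ) + 1)) ^ m * ENNReal.ofReal r ^ m) *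
              ((N : ℝ≥0∞) * μ (polarAt D z0)) := by rw [this, one_mul]
          _ = _ := by ring
    _ ≤ _ := by gcongr

lemma core (μ : Measure W) [μ.IsAddHaarMeasure] {w : W → ℝ} (hw : ConvexOn ℝ univ w)
    (hcont : Continuous w) {D : Set W} (hDdef : D = {y | w y ≤ 0}) (hD : IsCompact D)
    {y1 d' g : W} {s : ℝ} (hs : 0 < s) (hy1 : w y1 = -s) (hd' : d' ∈ D)
    (hmin : ∀ y ∈ D, -(2 * s) ≤ w y) {lam Lam : ℝ≥0∞}
    (hup : μ (subd w D) ≤ Lam * μ D)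
    (hlow : ∀ B ⊆ D, IsClosed B → lam * μ B ≤ μ (subd w B))
    {η : ℝ} (hη : 0 < η) (hg : ∀ y ∈ D, ⟪g, y - y1⟫ ≤ η) {N : ℕ} (hN : 0 < N)
    (hgd : 4 * N * η ≤ ⟪g, y1 - d'⟫) :
    (N : ℝ≥0∞) * lam ≤
      ENNReal.ofReal (16 * ((Module.finrank ℝ W : ℝ) + 1)) ^ (Module.finrank ℝ W) * Lam := by
  have hy1D : y1 ∈ D := by rw [hDdef]; simp only [mem_ofPred_eq]; linarith
  have hDc : Convex ℝ D := by
    rw [hDdef]; have := hw.convex_le 0; simpa using this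
  obtain ⟨z0, hz0D, hz0⟩ := exists_quasi_center hD hDc ⟨y1, hy1D⟩
  have hpol := polar_transl μ hy1D hd' hz0 hη hg hN hgd
  set m := Module.finrank ℝ W with hm
  -- step 1
  have st1 : s • polarAt D y1 ⊆ subd w D := by
    rintro _ ⟨p, hp, rfl⟩
    set q := s • p with hq
    have hqD : ∀ y ∈ D, ⟪q, y - y1⟫ ≤ s := by
      intro y hy
      have := hp y hy
      rw [hq, inner_smul_left]; simp only [conj_trivial]; nlinarith
    obtain ⟨y2, hy2, hmn⟩ := hD.exists_isMinOn ⟨y1, hy1D⟩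
      (f := fun y => w y - ⟪q, y⟫) (by fun_prop)
    refine ⟨y2, hy2, fun y => ?_⟩
    have hmn' : ∀ y ∈ D, w y2 - ⟪q, y2⟫ ≤ w y - ⟪q, y⟫ := fun y hy => hmn hy
    rw [inner_sub_right]
    by_cases hyD : y ∈ D
    · have := hmn' y hyD; linarith
    · have hwy : 0 < w y := by
        rw [hDdef] at hyD; simpa using hyD
      have hsw : 0 < s + w y := by linarith
      set θ := s / (s + w y) with hθ
      have hθ0 : 0 < θ := by positivity
      have hθ1 : θ ≤ 1 := by rw [hθ, div_le_one hsw]; linarith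
      have hyb : (1 - θ) • y1 + θ • y ∈ D := by
        rw [hDdef]
        have := hw.2 (mem_univ y1) (mem_univ y) (by linarith : 0 ≤ 1 - θ) hθ0.le (by ring)
        simp only [smul_eq_mul, hy1] at this
        refine this.trans (le_of_eq ?_)
        rw [hθ]; field_simp; ring
      have h1 := hqD _ hyb
      have h2 : (1 - θ) • y1 + θ • y - y1 = θ • (y - y1) := by module
      rw [h2, inner_smul_right, hθ, div_mul_eq_mul_div, div_le_iff₀ hsw] at h1
      have h3 : ⟪q, y - y1⟫ ≤ s + w y := le_of_mul_le_mul_left h1 hs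
      rw [inner_sub_right] at h3
      have h4 := hmn' y1 hy1D
      linarith
  have st1' : ENNReal.ofReal s ^ m * μ (polarAt D y1) ≤ Lam * μ D := by
    rw [← ofReal_pow_smul μ hs.le]
    exact (measure_mono st1).trans hup
  -- step 2
  let B : Set W := (fun y => (1/2 : ℝ) • y + (1/2:ℝ) • z0) '' D
  have hBD : B ⊆ D := by
    rintro _ ⟨y, hy, rfl⟩
    exact hDc hy hz0D (by norm_num) (by norm_num) (by norm_num)
  have hBcl : IsClosed B := (hD.image (by fun_prop)).isClosed
  have hBm : ENNReal.ofReal (1/2) ^ m * μ D = μ B := by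
    rw [← ofReal_pow_smul μ (by norm_num)]
    have : (1/2 : ℝ) • D = (fun h => h + (1/2:ℝ) • z0) ⁻¹' B := by
      ext q
      simp only [B, mem_preimage, mem_image, add_left_inj, Set.mem_smul_set]
    rw [this, measure_preimage_add_right]
  have st2 : subd w B ⊆ (4 * s) • polarAt D z0 := by
    rintro q ⟨_, ⟨z, hz, rfl⟩, hq⟩
    rw [Set.mem_smul_set_iff_inv_smul_mem₀ (by positivity)]
    intro y hy
    rw [inner_smul_left, conj_trivial, inv_mul_le_iff₀ (by positivity)]
    have h1 := hq ((1/2:ℝ) • z + (1/2:ℝ) • y)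
    have h2 : (1/2:ℝ) • z + (1/2:ℝ) • y ∈ D := hDc hz hy (by norm_num) (by norm_num) (by norm_num)
    have h3 : (1/2:ℝ) • z + (1/2:ℝ) • y - ((1/2:ℝ) • z + (1/2:ℝ) • z0) = (1/2:ℝ) • (y - z0) := by
      module
    simp only at h1
    rw [h3, inner_smul_right] at h1
    have h4 := hmin _ (hBD ⟨z, hz, rfl⟩)
    simp only at h4
    have h5 : w ((1/2:ℝ) • z + (1/2:ℝ) • y) ≤ 0 := by rw [hDdef] at h2; exact h2
    linarith
  have st2' : lam * (ENNReal.ofReal (1/2) ^ m * μ D) ≤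
      ENNReal.ofReal (4 * s) ^ m * μ (polarAt D z0) := by
    rw [hBm, ← ofReal_pow_smul μ (by positivity)]
    exact (hlow B hBD hBcl).trans (measure_mono st2)
  have hDpos : μ D ≠ 0 := by
    have : IsOpen {y | w y < 0} := isOpen_lt hcont continuous_const
    have h1 := this.measure_pos μ ⟨y1, by simp only [mem_ofPred_eq]; linarith⟩
    refine (h1.trans_le (measure_mono ?_)).ne'
    rw [hDdef]; intro y hy; rw [mem_ofPred_eq] at hy ⊢; exact hy.le
  have hDfin : μ D ≠ ∞ := hD.measure_lt_top.ne
  have hhalf : ENNReal.ofReal 2 ^ m * ENNReal.ofReal (1/2) ^ m = 1 := by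
    rw [← mul_pow, ← ENNReal.ofReal_mul (by positivity)]; norm_num
  have h16 : ENNReal.ofReal (16 * ((m : ℝ) + 1)) ^ m =
      ENNReal.ofReal 2 ^ m * ENNReal.ofReal 4 ^ m * ENNReal.ofReal (2 * ((m:ℝ)+1)) ^ m := by
    rw [← mul_pow, ← mul_pow, ← ENNReal.ofReal_mul (by positivity),
      ← ENNReal.ofReal_mul (by positivity)]
    congr 2; ring
  have h4s : ENNReal.ofReal (4 * s) ^ m = ENNReal.ofReal 4 ^ m * ENNReal.ofReal s ^ m := by
    rw [ENNReal.ofReal_mul (by positivity), mul_pow]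
  refine (ENNReal.mul_le_mul_iff_left hDpos hDfin).1 ?_
  calc (N : ℝ≥0∞) * lam * μ D
      = ENNReal.ofReal 2 ^ m * (N * (lam * (ENNReal.ofReal (1/2) ^ m * μ D))) := by
        calc _ = (ENNReal.ofReal 2 ^ m * ENNReal.ofReal (1/2) ^ m) * ((N : ℝ≥0∞) * lam * μ D) := by
              rw [hhalf, one_mul]
          _ = _ := by ring
    _ ≤ ENNReal.ofReal 2 ^ m * (N * (ENNReal.ofReal (4 * s) ^ m * μ (polarAt D z0))) := by gcongr
    _ = ENNReal.ofReal 2 ^ m * ENNReal.ofReal (4 * s) ^ m * (N * μ (polarAt D z0)) := by ring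
    _ ≤ ENNReal.ofReal 2 ^ m * ENNReal.ofReal (4 * s) ^ m *
          (ENNReal.ofReal (2 * ((m:ℝ)+1)) ^ m * μ (polarAt D y1)) := by gcongr
    _ = ENNReal.ofReal (16 * ((m : ℝ) + 1)) ^ m * (ENNReal.ofReal s ^ m * μ (polarAt D y1)) := by
        rw [h16, h4s]; ring
    _ ≤ ENNReal.ofReal (16 * ((m : ℝ) + 1)) ^ m * (Lam * μ D) := by gcongr
    _ = _ := by ring

lemma subd_tilt (μ : Measure W) [μ.IsAddHaarMeasure] (v : W → ℝ) (ε c : ℝ) (g : W) (B : Set W) :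
    μ (subd (fun y => v y - ε * (⟪g, y⟫ + c)) B) = μ (subd v B) := by
  have : subd (fun y => v y - ε * (⟪g, y⟫ + c)) B = (fun q => q + ε • g) ⁻¹' subd v B := by
    ext q
    simp only [subd, mem_preimage, mem_ofPred_eq]
    refine exists_congr fun z => and_congr_right fun _ => forall_congr' fun y => ?_
    rw [inner_add_left, inner_smul_left, conj_trivial, inner_sub_right g]
    constructor <;> intro h <;> linarith
  rw [this, measure_preimage_add_right]

theorem abstract_main (μ : Measure W) [μ.IsAddHaarMeasure] {v : W → ℝ} (hv : ConvexOn ℝ univ v)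
    (hcont : Continuous v) (hv0 : ∀ y, 0 ≤ v y) {r R : ℝ} (hr : 0 < r)
    (hcoer : ∀ y, r * ‖y‖ - R ≤ v y) {y0 y' : W} (hne : y0 ≠ y') (hy0 : v y0 = 0) (hy' : v y' = 0)
    {U : Set W} (hU : IsOpen U) (hCU : ∀ y, v y = 0 → y ≠ y0 → y ∈ U)
    (hMA : ∀ A ⊆ U, IsCompact A → ∃ lam Lam : ℝ≥0∞, lam ≠ 0 ∧ Lam ≠ ∞ ∧ ∀ B ⊆ A, IsClosed B →
      lam * μ B ≤ μ (subd v B) ∧ μ (subd v B) ≤ Lam * μ B) : False := by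
  set g : W := y' - y0 with hgdef
  have hg0 : 0 < ‖g‖ := norm_pos_iff.2 (sub_ne_zero.2 hne.symm)
  obtain ⟨c, hc⟩ : ∃ c : ℝ, c = - ⟪g, y0⟫ - ‖g‖ ^ 2 / 2 := ⟨_, rfl⟩
  let b : W → ℝ := fun y => ⟪g, y⟫ + c
  have hb : ∀ y, b y = ⟪g, y⟫ + c := fun _ => rfl
  have hbc : Continuous b := by fun_prop
  have hby' : b y' = ‖g‖ ^ 2 / 2 := by
    have h1 : y' = y0 + g := by rw [hgdef]; abel
    rw [hb, hc, h1, inner_add_right, real_inner_self_eq_norm_sq]; ring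
  have hby0 : b y0 = - (‖g‖ ^ 2 / 2) := by rw [hb, hc]; ring
  let D : ℝ → Set W := fun ε => {y | v y ≤ ε * b y}
  have hDmem : ∀ ε y, y ∈ D ε ↔ v y ≤ ε * b y := fun _ _ => Iff.rfl
  have hDcl : ∀ ε, IsClosed (D ε) := fun ε => isClosed_le hcont (by fun_prop)
  have hDb : ∀ ε > 0, ∀ y ∈ D ε, 0 ≤ b y := by
    intro ε hε y hy
    have := (hv0 y).trans hy
    exact nonneg_of_mul_nonneg_right this hε
  have hDmono : ∀ ε > 0, ∀ ε', ε ≤ ε' → D ε ⊆ D ε' := by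
    intro ε hε ε' hεε' y hy
    have h1 := hDb ε hε y hy
    have h2 : v y ≤ ε * b y := hy
    exact h2.trans (mul_le_mul_of_nonneg_right hεε' h1)
  obtain ⟨ε0, hε0, hDcp0⟩ : ∃ ε0 > 0, IsCompact (D ε0) := by
    refine ⟨r / (2 * ‖g‖), by positivity, ?_⟩
    refine Metric.isCompact_of_isClosed_isBounded (hDcl _) ?_
    rw [isBounded_iff_forall_norm_le]
    refine ⟨2 / r * (R + r / (2 * ‖g‖) * |c|), fun y hy => ?_⟩
    have h1 : v y ≤ r / (2 * ‖g‖) * (⟪g, y⟫ + c) := hy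
    have h2 := hcoer y
    have h3 : ⟪g, y⟫ + c ≤ ‖g‖ * ‖y‖ + |c| := add_le_add (real_inner_le_norm g y) (le_abs_self c)
    have h4 : r / (2 * ‖g‖) * (⟪g, y⟫ + c) ≤ r / (2 * ‖g‖) * (‖g‖ * ‖y‖ + |c|) := by gcongr
    have h5 : r / (2 * ‖g‖) * (‖g‖ * ‖y‖ + |c|) = r / 2 * ‖y‖ + r / (2 * ‖g‖) * |c| := by
      field_simp
    have h6 : r / 2 * ‖y‖ ≤ R + r / (2 * ‖g‖) * |c| := by linarith
    calc ‖y‖ = 2 / r * (r / 2 * ‖y‖) := by field_simp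
      _ ≤ _ := by gcongr
  -- the zero set
  have hCcp : IsCompact (D ε0 ∩ {y | v y = 0}) :=
    hDcp0.inter_right (isClosed_eq hcont continuous_const)
  have hy'D : ∀ ε > 0, y' ∈ D ε := by
    intro ε hε; rw [hDmem, hy', hby']; positivity
  obtain ⟨y1, ⟨hy1D, hy1v⟩, hmax⟩ := hCcp.exists_isMaxOn ⟨y', hy'D _ hε0, hy'⟩ hbc.continuousOn
  have hmax' : ∀ y ∈ D ε0, v y = 0 → b y ≤ b y1 := fun y hy hy2 => hmax ⟨hy, hy2⟩
  have hβ : 0 < b y1 := by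
    have := hmax' y' (hy'D _ hε0) hy'
    rw [hby'] at this
    exact lt_of_lt_of_le (by positivity) this
  set β := b y1 with hβdef
  have hshrink : ∀ η > 0, ∃ ε1 > 0, ∀ ε > 0, ε ≤ ε1 → ε ≤ ε0 ∧ ∀ y ∈ D ε, y ∈ U ∧ b y < β + η := by
    intro η hη
    let bad : Set W := D ε0 ∩ (Uᶜ ∪ {y | β + η ≤ b y})
    have hbad : IsCompact bad :=
      hDcp0.inter_right (hU.isClosed_compl.union (isClosed_le continuous_const hbc))
    have hpos : ∀ y ∈ bad, 0 < v y := by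
      rintro y ⟨hyD, hy⟩
      refine lt_of_le_of_ne (hv0 y) fun h => ?_
      have h1 := hmax' y hyD h.symm
      have h2 := hDb _ hε0 y hyD
      rcases hy with hy | hy
      · refine hy (hCU y h.symm ?_)
        rintro rfl
        rw [hby0] at h2
        have : 0 < ‖g‖ ^ 2 / 2 := by positivity
        linarith
      · rw [mem_ofPred_eq] at hy; linarith
    by_cases hbe : bad.Nonempty
    · obtain ⟨ya, hya, hmina⟩ := hbad.exists_isMinOn hbe hcont.continuousOn
      obtain ⟨yb, hyb, hmaxb⟩ := hbad.exists_isMaxOn hbe hbc.continuousOn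
      have hκ := hpos ya hya
      have hM : 0 ≤ b yb := hDb _ hε0 yb hyb.1
      refine ⟨min ε0 (v ya / (2 * (b yb + 1))), lt_min hε0 (by positivity), fun ε hε hle => ?_⟩
      refine ⟨hle.trans (min_le_left _ _), fun y hy => ?_⟩
      by_contra hcon
      have hyb' : y ∈ bad := by
        refine ⟨hDmono ε hε _ (hle.trans (min_le_left _ _)) hy, ?_⟩
        by_cases hyU : y ∈ U
        · right; rw [mem_ofPred_eq]; by_contra h; exact hcon ⟨hyU, not_le.1 h⟩
        · left; exact hyU
      have h1 : v ya ≤ v y := hmina hyb'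
      have h2 : b y ≤ b yb := hmaxb hyb'
      have h3 : v y ≤ ε * b y := hy
      have h4 := hle.trans (min_le_right _ _)
      rw [le_div_iff₀ (by positivity)] at h4
      have h5 : ε * b y ≤ ε * b yb := by gcongr
      nlinarith
    · refine ⟨ε0, hε0, fun ε hε hle => ⟨hle, fun y hy => ?_⟩⟩
      by_contra hcon
      refine hbe ⟨y, hDmono ε hε _ hle hy, ?_⟩
      by_cases hyU : y ∈ U
      · right; rw [mem_ofPred_eq]; by_contra h; exact hcon ⟨hyU, not_le.1 h⟩
      · left; exact hyU
  obtain ⟨ε1, hε1, h1⟩ := hshrink β hβ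
  have hA : D ε1 ⊆ U := fun y hy => ((h1 ε1 hε1 le_rfl).2 y hy).1
  have hAc : IsCompact (D ε1) :=
    hDcp0.of_isClosed_subset (hDcl _) (hDmono _ hε1 _ (h1 ε1 hε1 le_rfl).1)
  obtain ⟨lam, Lam, hlam, hLam, hMA'⟩ := hMA _ hA hAc
  set m := Module.finrank ℝ W with hm
  set Q : ℝ≥0∞ := ENNReal.ofReal (16 * ((m : ℝ) + 1)) ^ m * Lam with hQ
  have hQfin : Q ≠ ∞ := ENNReal.mul_ne_top (ENNReal.pow_ne_top ENNReal.ofReal_ne_top) hLam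
  obtain ⟨N, hN⟩ := ENNReal.exists_nat_mul_gt hlam hQfin
  have hN0 : 0 < N := by
    rcases Nat.eq_zero_or_pos N with h | h
    · simp [h] at hN
    · exact h
  have hNr : (0:ℝ) < N := by exact_mod_cast hN0
  set η := β / (4 * N) with hη
  have hη0 : 0 < η := by positivity
  obtain ⟨ε2, hε2, h2⟩ := hshrink η hη0
  set ε := min ε1 ε2 with hε
  have hεp : 0 < ε := lt_min hε1 hε2
  have hsub : D ε ⊆ D ε1 := hDmono _ hεp _ (min_le_left _ _)
  refine absurd ?_ (not_le.2 hN)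
  have hwconv : ConvexOn ℝ univ (fun y => v y - ε * (⟪g, y⟫ + c)) := by
    refine ⟨convex_univ, fun a _ a' _ s t hs ht hst => ?_⟩
    have := hv.2 (mem_univ a) (mem_univ a') hs ht hst
    simp only [smul_eq_mul, inner_add_right, inner_smul_right] at this ⊢
    have hcc : ε * c = s * (ε * c) + t * (ε * c) := by rw [← add_mul, hst, one_mul]
    linarith
  refine core μ (w := fun y => v y - ε * (⟪g, y⟫ + c)) (D := D ε) hwconv (by fun_prop) ?_
    (hAc.of_isClosed_subset (hDcl _) hsub) (y1 := y1) (d' := (1/2:ℝ) • y0 + (1/2:ℝ) • y') (g := g)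
    (s := ε * β) (by positivity) ?_ ?_ ?_ ?_ ?_ hη0 ?_ hN0 ?_
  · ext y; simp only [hDmem, mem_ofPred_eq, sub_nonpos, hb]
  · have : v y1 = 0 := hy1v
    simp only [this, hβdef, hb]; ring
  · rw [hDmem]
    have h1 := hv.2 (mem_univ y0) (mem_univ y') (by norm_num : (0:ℝ) ≤ 1/2)
      (by norm_num : (0:ℝ) ≤ 1/2) (by norm_num)
    have h2 : b ((1/2:ℝ) • y0 + (1/2:ℝ) • y') = (1/2) * b y0 + (1/2) * b y' := by
      simp only [hb, inner_add_right, inner_smul_right]; ring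
    rw [h2, hby0, hby']
    simp only [hy0, hy', smul_zero, add_zero] at h1
    linarith
  · intro y hy
    have h3 := ((h1 ε1 hε1 le_rfl).2 y (hsub hy)).2
    have h4 := hv0 y
    have h5 : ε * (⟪g, y⟫ + c) ≤ ε * (2 * β) := by
      gcongr; rw [hb] at h3; linarith
    linarith
  · rw [subd_tilt]; exact (hMA' _ hsub (hDcl _)).2
  · intro B hB hBc
    rw [subd_tilt]; exact (hMA' _ (hB.trans hsub) hBc).1
  · intro y hy
    have h3 := ((h2 ε hεp (min_le_right _ _)).2 y hy).2
    rw [hβdef, hb, hb] at h3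
    rw [inner_sub_right]; linarith
  · have h3 : 4 * N * η = β := by rw [hη]; field_simp
    have h4 : ⟪g, (1/2:ℝ) • y0 + (1/2:ℝ) • y'⟫ + c = 0 := by
      have h2 : b ((1/2:ℝ) • y0 + (1/2:ℝ) • y') = (1/2) * b y0 + (1/2) * b y' := by
        simp only [hb, inner_add_right, inner_smul_right]; ring
      rw [hby0, hby'] at h2
      rw [← hb, h2]; ring
    rw [h3, inner_sub_right, hβdef, hb]; linarith

end Abstract

section Concrete

lemma anti_meas {X Y : Type*} [MetricSpace X] [MetricSpace Y] [MeasurableSpace X] [BorelSpace X]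
    [MeasurableSpace Y] [BorelSpace Y] {s : Set X} {g : X → Y} {L : ℝ≥0} {d : ℝ} (hd : 0 ≤ d)
    (h : ∀ x ∈ s, ∀ y ∈ s, dist x y ≤ L * dist (g x) (g y)) :
    μH[d] s ≤ (L : ℝ≥0∞) ^ d * μH[d] (g '' s) := by
  rcases s.eq_empty_or_nonempty with rfl | ⟨x0, hx0⟩
  · simp
  have : Nonempty X := ⟨x0⟩
  have hinj : InjOn g s := by
    intro x hx y hy hxy
    have := h x hx y hy
    rw [hxy, dist_self, mul_zero] at this
    exact dist_le_zero.1 this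
  have hlip : LipschitzOnWith L (Function.invFunOn g s) (g '' s) := by
    refine LipschitzOnWith.of_dist_le_mul ?_
    rintro _ ⟨x, hx, rfl⟩ _ ⟨y, hy, rfl⟩
    rw [hinj.leftInvOn_invFunOn hx, hinj.leftInvOn_invFunOn hy]
    exact h x hx y hy
  have := hlip.hausdorffMeasure_image_le hd
  rwa [hinj.leftInvOn_invFunOn.image_image] at this

variable {n : ℕ}

local notation "EE" => EuclideanSpace ℝ (Fin n)

lemma le_suppFn {K : Set EE} (hK : IsCompact K) (u : EE) {y : EE} (hy : y ∈ K) :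
    ⟪u, y⟫ ≤ suppFn K u :=
  le_csSup (hK.image (by fun_prop)).bddAbove ⟨y, hy, rfl⟩

lemma suppFn_le {K : Set EE} (hne : K.Nonempty) {u : EE} {c : ℝ} (h : ∀ y ∈ K, ⟪u, y⟫ ≤ c) :
    suppFn K u ≤ c := by
  refine csSup_le (hne.image _) ?_
  rintro _ ⟨y, hy, rfl⟩
  exact h y hy

lemma suppFn_smul {K : Set EE} (hK : IsCompact K) (hne : K.Nonempty) {t : ℝ} (ht : 0 ≤ t) (u : EE) :
    suppFn K (t • u) = t * suppFn K u := by
  have h1 : ∀ (t : ℝ), 0 ≤ t → ∀ u : EE, suppFn K (t • u) ≤ t * suppFn K u := by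
    intro t ht u
    refine suppFn_le hne fun y hy => ?_
    rw [inner_smul_left, conj_trivial]
    exact mul_le_mul_of_nonneg_left (le_suppFn hK u hy) ht
  refine le_antisymm (h1 t ht u) ?_
  rcases ht.eq_or_lt with rfl | ht'
  · obtain ⟨y, hy⟩ := hne
    have := le_suppFn hK ((0:ℝ) • u) hy
    simpa using this
  · have := h1 t⁻¹ (by positivity) (t • u)
    rw [smul_smul, inv_mul_cancel₀ ht'.ne', one_smul] at this
    rwa [le_inv_mul_iff₀ ht'] at this

lemma suppFn_add_le {K : Set EE} (hK : IsCompact K) (hne : K.Nonempty) (u u' : EE) :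
    suppFn K (u + u') ≤ suppFn K u + suppFn K u' := by
  refine suppFn_le hne fun y hy => ?_
  rw [inner_add_left]
  exact add_le_add (le_suppFn hK u hy) (le_suppFn hK u' hy)

lemma suppFn_convex {K : Set EE} (hK : IsCompact K) (hne : K.Nonempty) :
    ConvexOn ℝ univ (suppFn K) := by
  refine ⟨convex_univ, fun a _ b _ s t hs ht _ => ?_⟩
  refine (suppFn_add_le hK hne _ _).trans ?_
  rw [suppFn_smul hK hne hs, suppFn_smul hK hne ht]; rfl

lemma suppFn_continuous {K : Set EE} (hK : IsCompact K) (hne : K.Nonempty) :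
    Continuous (suppFn K) := by
  exact (suppFn_convex hK hne).locallyLipschitz.continuous

/-- support inequalities characterise membership -/
lemma mem_of_supp {K : Set EE} (hK : IsCompact K) (hc : Convex ℝ K) (hne : K.Nonempty) {z : EE}
    (h : ∀ u, ⟪z, u⟫ ≤ suppFn K u) : z ∈ K := by
  by_contra hz
  obtain ⟨f, c, h1, h2⟩ := geometric_hahn_banach_closed_point hc hK.isClosed hz
  set u := (InnerProductSpace.toDual ℝ EE).symm f with hu
  have hfu : ∀ y, f y = ⟪u, y⟫ := fun y => by rw [hu, InnerProductSpace.toDual_symm_apply]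
  have h3 : suppFn K u ≤ c := suppFn_le hne fun y hy => by rw [← hfu]; exact (h1 y hy).le
  have h4 := h u
  rw [real_inner_comm, ← hfu] at h4
  linarith

/-- projection to the hyperplane -/
def projW (e : EE) (he : ‖e‖ = 1) (z : EE) : (ℝ ∙ e)ᗮ :=
  ⟨z - ⟪e, z⟫ • e, by
    rw [Submodule.mem_orthogonal_singleton_iff_inner_right, inner_sub_right, inner_smul_right,
      real_inner_self_eq_norm_sq, he]; ring⟩

lemma coe_projW (e : EE) (he : ‖e‖ = 1) (z : EE) : (projW e he z : EE) = z - ⟪e, z⟫ • e := rfl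

lemma inner_e (e : EE) (y : (ℝ ∙ e)ᗮ) : ⟪e, (y : EE)⟫ = 0 :=
  Submodule.mem_orthogonal_singleton_iff_inner_right.1 y.2

lemma inner_e' (e : EE) (y : (ℝ ∙ e)ᗮ) : ⟪(y : EE), e⟫ = 0 := by
  rw [real_inner_comm]; exact inner_e e y

lemma inner_projW (e : EE) (he : ‖e‖ = 1) (z : EE) (y : (ℝ ∙ e)ᗮ) :
    ⟪projW e he z, y⟫ = ⟪z, (y : EE)⟫ := by
  rw [Submodule.coe_inner, coe_projW, inner_sub_left, inner_smul_left, inner_e]; simp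

lemma projW_sub (e : EE) (he : ‖e‖ = 1) (z z' : EE) :
    projW e he z - projW e he z' = projW e he (z - z') := by
  apply Subtype.ext
  rw [Submodule.coe_sub, coe_projW, coe_projW, coe_projW, inner_sub_right]; module

lemma projW_norm_le (e : EE) (he : ‖e‖ = 1) (z : EE) : ‖projW e he z‖ ≤ 2 * ‖z‖ := by
  rw [Submodule.coe_norm, coe_projW]
  refine (norm_sub_le _ _).trans ?_
  rw [norm_smul, he, mul_one, Real.norm_eq_abs]
  have := abs_real_inner_le_norm e z
  rw [he, one_mul] at this
  linarith

lemma norm_e_add (e : EE) (he : ‖e‖ = 1) (y : (ℝ ∙ e)ᗮ) : 1 ≤ ‖e + (y : EE)‖ := by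
  have h := real_inner_le_norm e (e + (y:EE))
  rw [inner_add_right, inner_e, real_inner_self_eq_norm_sq, he] at h
  linarith

/-- radial projection to sphere -/
def rad (e : EE) (y : (ℝ ∙ e)ᗮ) : EE := ‖e + (y : EE)‖⁻¹ • (e + (y : EE))

lemma rad_lip (e : EE) (he : ‖e‖ = 1) : LipschitzWith 2 (rad e) := by
  refine LipschitzWith.of_dist_le_mul fun y y' => ?_
  rw [dist_eq_norm, dist_eq_norm, Submodule.coe_norm, Submodule.coe_sub]
  unfold rad
  set a := e + (y : EE) with ha
  set b := e + (y' : EE) with hb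
  have h1 : 1 ≤ ‖a‖ := norm_e_add e he y
  have h2 : 1 ≤ ‖b‖ := norm_e_add e he y'
  have hab : (y : EE) - y' = a - b := by rw [ha, hb]; abel
  have key : ‖a‖⁻¹ • a - ‖b‖⁻¹ • b = ‖a‖⁻¹ • ((a - b) + ((‖b‖ - ‖a‖) * ‖b‖⁻¹) • b) := by
    have e1 : (‖b‖ - ‖a‖) * ‖b‖⁻¹ = 1 - ‖a‖ * ‖b‖⁻¹ := by
      rw [sub_mul, mul_inv_cancel₀ (by linarith)]
    rw [e1, sub_smul, one_smul, mul_smul]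
    have e2 : ‖a‖⁻¹ • ‖a‖ • ‖b‖⁻¹ • b = ‖b‖⁻¹ • b := by
      rw [smul_smul, inv_mul_cancel₀ (by linarith), one_smul]
    rw [sub_add_sub_cancel, smul_sub, e2]
  rw [key, norm_smul, hab, norm_inv, norm_norm]
  have h3 : ‖(a - b) + ((‖b‖ - ‖a‖) * ‖b‖⁻¹) • b‖ ≤ 2 * ‖a - b‖ := by
    refine (norm_add_le _ _).trans ?_
    rw [norm_smul, norm_mul, norm_inv, norm_norm, mul_assoc, inv_mul_cancel₀ (by linarith), mul_one,
      Real.norm_eq_abs, abs_sub_comm]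
    have := abs_norm_sub_norm_le a b
    linarith
  calc _ ≤ 1 * (2 * ‖a - b‖) := by
        gcongr
        exact inv_le_one_of_one_le₀ h1
    _ = _ := by simp

lemma rad_anti (e : EE) (he : ‖e‖ = 1) {M : ℝ} (y y' : (ℝ ∙ e)ᗮ)
    (hy : ‖e + (y : EE)‖ ≤ M) (hy' : ‖e + (y' : EE)‖ ≤ M) :
    dist y y' ≤ (M + M * M) * dist (rad e y) (rad e y') := by
  rw [dist_eq_norm, dist_eq_norm, Submodule.coe_norm, Submodule.coe_sub]
  have h1 : 1 ≤ ‖e + (y : EE)‖ := norm_e_add e he y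
  have h2 : 1 ≤ ‖e + (y' : EE)‖ := norm_e_add e he y'
  have i1 : ⟪e, rad e y⟫ = ‖e + (y : EE)‖⁻¹ := by
    rw [rad, inner_smul_right, inner_add_right, inner_e, real_inner_self_eq_norm_sq, he]; simp
  have i2 : ⟪e, rad e y'⟫ = ‖e + (y' : EE)‖⁻¹ := by
    rw [rad, inner_smul_right, inner_add_right, inner_e, real_inner_self_eq_norm_sq, he]; simp
  have j1 : e + (y : EE) = ‖e + (y : EE)‖ • rad e y := by
    rw [rad, smul_smul, mul_inv_cancel₀ (by linarith), one_smul]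
  have j2 : e + (y' : EE) = ‖e + (y' : EE)‖ • rad e y' := by
    rw [rad, smul_smul, mul_inv_cancel₀ (by linarith), one_smul]
  have n2 : ‖rad e y'‖ = 1 := by
    rw [rad, norm_smul, norm_inv, norm_norm, inv_mul_cancel₀ (by linarith)]
  set α := ‖e + (y : EE)‖
  set γ := ‖e + (y' : EE)‖
  have hab : (y : EE) - y' = α • (rad e y - rad e y') + (α - γ) • rad e y' := by
    have : (y : EE) - y' = (e + (y:EE)) - (e + (y':EE)) := by abel
    rw [this, j1, j2]; module
  have k : |α - γ| ≤ M * M * ‖rad e y - rad e y'‖ := by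
    have k1 : α - γ = α * γ * ⟪e, rad e y' - rad e y⟫ := by
      rw [inner_sub_right, i1, i2]; field_simp
    have k2 := abs_real_inner_le_norm e (rad e y' - rad e y)
    rw [he, one_mul, norm_sub_rev] at k2
    rw [k1, abs_mul, abs_of_nonneg (by positivity : 0 ≤ α * γ)]
    have hM0 : 0 ≤ M := by linarith
    gcongr
  rw [hab]
  refine (norm_add_le _ _).trans ?_
  rw [norm_smul, norm_smul, n2, mul_one, Real.norm_eq_abs, Real.norm_eq_abs, abs_of_nonneg (by linarith), add_mul]
  gcongr

lemma face_smul {K : Set EE} (hK : IsCompact K) (hne : K.Nonempty) {t : ℝ} (ht : 0 < t) (u : EE) :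
    face K (t • u) = face K u := by
  ext z
  simp only [face, mem_ofPred_eq, suppFn_smul hK hne ht.le, inner_smul_right]
  refine and_congr_right fun _ => ⟨fun h => mul_left_cancel₀ ht.ne' h, fun h => by rw [h]⟩

/-- The function in the chart. -/
def chartFn (K : Set EE) (x e : EE) (y : (ℝ ∙ e)ᗮ) : ℝ :=
  suppFn K (e + (y : EE)) - ⟪x, e + (y : EE)⟫

lemma subd_chart {K : Set EE} (hK : IsCompact K) (hc : Convex ℝ K) (hne : K.Nonempty)
    (x e : EE) (he : ‖e‖ = 1) (B : Set (ℝ ∙ e)ᗮ) :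
    subd (chartFn K x e) B =
      (fun q => q + projW e he x) ⁻¹' (projW e he '' ⋃ u ∈ rad e '' B, face K u) := by
  have hface : ∀ y, face K (rad e y) = face K (e + (y : EE)) := fun y =>
    face_smul hK hne (inv_pos.2 (by linarith [norm_e_add e he y])) _
  have hsplit : ∀ (z : EE) (y : (ℝ ∙ e)ᗮ), ⟪z, e + (y:EE)⟫ = ⟪e, z⟫ + ⟪projW e he z, y⟫ := by
    intro z y
    rw [inner_add_right, inner_projW, real_inner_comm]
  ext q
  constructor
  · rintro ⟨y, hy, hq⟩
    obtain ⟨t, ht⟩ : ∃ t, t = suppFn K (e + (y:EE)) - ⟪x + (q:EE), e + (y:EE)⟫ := ⟨_, rfl⟩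
    set z : EE := x + (q : EE) + t • e with hz
    have hz0 : ∀ y : (ℝ ∙ e)ᗮ, ⟪z, e + (y:EE)⟫ = ⟪x, e + (y:EE)⟫ + ⟪q, y⟫ + t := by
      intro y
      rw [hz, inner_add_left, inner_add_left, inner_smul_left, inner_add_right e, inner_e,
        real_inner_self_eq_norm_sq, he, inner_add_right (q : EE), inner_e', Submodule.coe_inner]
      simp
    have hqy : ⟪x + (q:EE), e + (y:EE)⟫ = ⟪x, e + (y:EE)⟫ + ⟪q, y⟫ := by
      rw [inner_add_left, inner_add_right (q:EE), inner_e', zero_add, Submodule.coe_inner]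
    have hzy : ⟪z, e + (y:EE)⟫ = suppFn K (e + (y:EE)) := by
      rw [hz0, ht, hqy]; ring
    have hle : ∀ y' : (ℝ ∙ e)ᗮ, ⟪z, e + (y':EE)⟫ ≤ suppFn K (e + (y':EE)) := by
      intro y'
      have := hq y'
      rw [chartFn, chartFn, inner_sub_right] at this
      rw [hz0, ht, hqy]; linarith
    have hpos : ∀ u : EE, 0 < ⟪e, u⟫ → ⟪z, u⟫ ≤ suppFn K u := by
      intro u hu
      have hu' : u = ⟪e, u⟫ • (e + ((⟪e, u⟫⁻¹ • projW e he u : (ℝ ∙ e)ᗮ) : EE)) := by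
        rw [Submodule.coe_smul, smul_add, smul_smul, mul_inv_cancel₀ hu.ne', one_smul, coe_projW]
        abel
      rw [hu', suppFn_smul hK hne hu.le, inner_smul_right]
      exact mul_le_mul_of_nonneg_left (hle _) hu.le
    have hall : ∀ u : EE, ⟪z, u⟫ ≤ suppFn K u := by
      intro u
      have he1 : ⟪e, e + (y:EE)⟫ = 1 := by
        rw [inner_add_right, inner_e, real_inner_self_eq_norm_sq, he]; simp
      set s := |⟪e, u⟫| + 1 with hs
      have hs0 : 0 ≤ s := by positivity
      have h1 := hpos (u + s • (e + (y:EE))) (by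
        rw [inner_add_right, inner_smul_right, he1]
        have := neg_abs_le ⟪e, u⟫
        linarith)
      have h2 := suppFn_add_le hK hne u (s • (e + (y:EE)))
      rw [suppFn_smul hK hne hs0] at h2
      rw [inner_add_right, inner_smul_right, hzy] at h1
      linarith
    refine ⟨z, ?_, ?_⟩
    · simp only [mem_iUnion]
      refine ⟨rad e y, ⟨y, hy, rfl⟩, ?_⟩
      rw [hface]
      exact ⟨mem_of_supp hK hc hne hall, hzy⟩
    · apply Subtype.ext
      rw [Submodule.coe_add, coe_projW, coe_projW, hz, inner_add_right, inner_add_right, inner_e,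
        inner_smul_right, real_inner_self_eq_norm_sq, he]
      module
  · rintro ⟨z, hz, hzq⟩
    simp only [mem_iUnion] at hz
    obtain ⟨_, ⟨y, hy, rfl⟩, hzf⟩ := hz
    rw [hface] at hzf
    obtain ⟨hzK, hzy⟩ := hzf
    refine ⟨y, hy, fun y' => ?_⟩
    have h1 := le_suppFn hK (e + (y':EE)) hzK
    rw [real_inner_comm] at h1
    have hq : q = projW e he z - projW e he x := by rw [hzq]; simp
    rw [chartFn, chartFn, ← hzy, hq, inner_sub_left, inner_sub_right, inner_sub_right]
    rw [hsplit] at h1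
    rw [hsplit, hsplit, hsplit]
    linarith

lemma proj_anti {K : Set EE} (hK : IsCompact K) (hne : K.Nonempty) (e : EE) (he : ‖e‖ = 1) {M : ℝ}
    (y y' : (ℝ ∙ e)ᗮ) (hy : ‖(y : EE)‖ ≤ M) (hy' : ‖(y' : EE)‖ ≤ M) {z z' : EE}
    (hz : z ∈ face K (rad e y)) (hz' : z' ∈ face K (rad e y')) :
    dist z z' ≤ (1 + M) * dist (projW e he z) (projW e he z') := by
  have hface : ∀ y, face K (rad e y) = face K (e + (y : EE)) := fun y =>
    face_smul hK hne (inv_pos.2 (by linarith [norm_e_add e he y])) _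
  rw [hface] at hz hz'
  have hsplit : ∀ (z : EE) (y : (ℝ ∙ e)ᗮ), ⟪z, e + (y:EE)⟫ = ⟪e, z⟫ + ⟪projW e he z, y⟫ := by
    intro z y
    rw [inner_add_right, inner_projW, real_inner_comm]
  have a1 : 0 ≤ ⟪z - z', e + (y:EE)⟫ := by
    have := le_suppFn hK (e + (y:EE)) hz'.1
    rw [real_inner_comm] at this
    rw [inner_sub_left, hz.2]; linarith
  have a2 : ⟪z - z', e + (y':EE)⟫ ≤ 0 := by
    have := le_suppFn hK (e + (y':EE)) hz.1
    rw [real_inner_comm] at this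
    rw [inner_sub_left, hz'.2]; linarith
  rw [dist_eq_norm, dist_eq_norm, projW_sub]
  rw [hsplit] at a1 a2
  set d := z - z'
  have hd : d = (projW e he d : EE) + ⟪e, d⟫ • e := by rw [coe_projW]; abel
  have b1 := abs_real_inner_le_norm (projW e he d) y
  have b2 := abs_real_inner_le_norm (projW e he d) y'
  have hn : ‖y‖ ≤ M := hy
  have hn' : ‖y'‖ ≤ M := hy'
  have c1 : ‖projW e he d‖ * ‖y‖ ≤ M * ‖projW e he d‖ := by rw [mul_comm]; gcongr
  have c2 : ‖projW e he d‖ * ‖y'‖ ≤ M * ‖projW e he d‖ := by rw [mul_comm]; gcongr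
  have t : |⟪e, d⟫| ≤ M * ‖projW e he d‖ := by
    rw [abs_le]
    have := abs_le.1 b1
    have := abs_le.1 b2
    constructor <;> linarith
  calc ‖d‖ = ‖(projW e he d : EE) + ⟪e, d⟫ • e‖ := by rw [← hd]
    _ ≤ ‖projW e he d‖ + |⟪e, d⟫| := by
      refine (norm_add_le _ _).trans ?_
      rw [norm_smul, he, mul_one, Real.norm_eq_abs, Submodule.coe_norm]
    _ ≤ _ := by linarith

lemma transfer {p : ℝ} {τ1 τ2 : ℝ} (hn : 2 ≤ n)
    (hτ1 : 0 < τ1) (hτ12 : τ1 < τ2) {f : EE → ℝ}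
    (hf : ∀ u ∈ unitSphere n, τ1 < f u ∧ f u < τ2)
    {K : Set EE} (hK : IsConvexBody0 K) (hsol : IsLpSolution p f K)
    (x e : EE) (he : ‖e‖ = 1) (d : ℝ) (hd : d = (n : ℝ) - 1)
    [(μH[d] : Measure (ℝ ∙ e)ᗮ).IsAddHaarMeasure] (A : Set (ℝ ∙ e)ᗮ)
    (hA : A ⊆ {y | 0 < suppFn K (e + (y : EE))}) (hAc : IsCompact A) :
    ∃ lam Lam : ℝ≥0∞, lam ≠ 0 ∧ Lam ≠ ∞ ∧ ∀ B ⊆ A, IsClosed B →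
      lam * (μH[d] : Measure (ℝ ∙ e)ᗮ) B ≤ μH[d] (subd (chartFn K x e) B) ∧
      μH[d] (subd (chartFn K x e) B) ≤ Lam * μH[d] B := by
  obtain ⟨hKc, hKcv, -, h0K⟩ := hK
  have hne : K.Nonempty := ⟨0, h0K⟩
  obtain ⟨-, hsol⟩ := hsol
  have hn2 : (2:ℝ) ≤ n := by exact_mod_cast hn
  have hd0 : 0 ≤ d := by rw [hd]; linarith
  have hradc : Continuous (rad e) := (rad_lip e he).continuous
  have hsc := suppFn_continuous hKc hne
  have hradpos : ∀ y ∈ A, 0 < suppFn K (rad e y) := by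
    intro y hy
    have h1 := norm_e_add e he y
    rw [rad, suppFn_smul hKc hne (by positivity)]
    exact mul_pos (by positivity) (hA hy)
  have hrads : ∀ y, rad e y ∈ unitSphere n := by
    intro y
    have h1 := norm_e_add e he y
    simp only [unitSphere, mem_sphere_zero_iff_norm]
    rw [rad, norm_smul, norm_inv, norm_norm, inv_mul_cancel₀ (by linarith)]
  have hφc : ContinuousOn (fun y => suppFn K (rad e y) ^ (p - 1)) A :=
    ContinuousOn.rpow_const (hsc.comp hradc).continuousOn fun y hy => Or.inl (hradpos y hy).ne'
  obtain ⟨c1, hc1, hc1'⟩ : ∃ c1 > 0, ∀ y ∈ A, c1 ≤ suppFn K (rad e y) ^ (p - 1) :=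
    hAc.exists_forall_le' hφc fun y hy => Real.rpow_pos_of_pos (hradpos y hy) _
  obtain ⟨c2, hc2⟩ := hAc.bddAbove_image hφc
  have hc2' : ∀ y ∈ A, suppFn K (rad e y) ^ (p - 1) ≤ c2 := fun y hy => hc2 ⟨y, hy, rfl⟩
  obtain ⟨M0, hM0⟩ := isBounded_iff_forall_norm_le.1 hAc.isBounded
  obtain ⟨M, hM, hM1⟩ : ∃ M : ℝ≥0, M0 ≤ M ∧ 1 ≤ M :=
    ⟨⟨max M0 1, by positivity⟩, le_max_left _ _, le_max_right M0 1⟩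
  have hMA : ∀ y ∈ A, ‖(y : EE)‖ ≤ M := fun y hy => (hM0 y hy).trans hM
  have hMA' : ∀ y ∈ A, ‖e + (y : EE)‖ ≤ (1 + M : ℝ≥0) := by
    intro y hy
    refine (norm_add_le _ _).trans ?_
    rw [he]; push_cast; have := hMA y hy; linarith
  set k1 : ℝ≥0∞ := ENNReal.ofReal (n * τ1 * c1) with hk1
  set k2 : ℝ≥0∞ := ENNReal.ofReal (n * τ2 * c2) with hk2
  set L1 : ℝ≥0 := (1 + M) + (1 + M) * (1 + M) with hL1
  set a : ℝ≥0∞ := (L1 : ℝ≥0∞) ^ d with ha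
  set b : ℝ≥0∞ := ((1 + M : ℝ≥0) : ℝ≥0∞) ^ d with hb
  have hafin : a ≠ ∞ := ENNReal.rpow_ne_top_of_nonneg hd0 ENNReal.coe_ne_top
  have hbfin : b ≠ ∞ := ENNReal.rpow_ne_top_of_nonneg hd0 ENNReal.coe_ne_top
  have h2fin : ((2 : ℝ≥0) : ℝ≥0∞) ^ d ≠ ∞ := ENNReal.rpow_ne_top_of_nonneg hd0 ENNReal.coe_ne_top
  refine ⟨b⁻¹ * (k1 * a⁻¹), ((2 : ℝ≥0) : ℝ≥0∞) ^ d * (k2 * ((2 : ℝ≥0) : ℝ≥0∞) ^ d), ?_, ?_, ?_⟩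
  · refine mul_ne_zero (ENNReal.inv_ne_zero.2 hbfin) (mul_ne_zero ?_ (ENNReal.inv_ne_zero.2 hafin))
    rw [hk1, Ne, ENNReal.ofReal_eq_zero, not_le]
    have : (0:ℝ) < n := by linarith
    positivity
  · exact ENNReal.mul_ne_top h2fin (ENNReal.mul_ne_top ENNReal.ofReal_ne_top h2fin)
  intro B hBA hBcl
  have hBc : IsCompact B := hAc.of_isClosed_subset hBcl hBA
  set ω := rad e '' B with hω
  have hωm : MeasurableSet ω := (hBc.image hradc).measurableSet
  have hωs : ω ⊆ {u ∈ unitSphere n | 0 < suppFn K u} := by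
    rintro _ ⟨y, hy, rfl⟩
    exact ⟨hrads y, hradpos y (hBA hy)⟩
  have hV := hsol ω hωm hωs
  rw [surfMeas, ← hd] at hV
  set V := ⋃ u ∈ ω, face K u with hVdef
  have hVlow : k1 * μH[d] ω ≤ μH[d] V := by
    rw [hV, ← setLIntegral_const]
    refine setLIntegral_mono' hωm ?_
    rintro _ ⟨y, hy, rfl⟩
    refine ENNReal.ofReal_le_ofReal ?_
    have h1 := hc1' y (hBA hy)
    have h2 := (hf _ (hrads y)).1
    have hn0 : (0:ℝ) ≤ n := Nat.cast_nonneg n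
    have h3 : 0 ≤ (n:ℝ) * f (rad e y) := mul_nonneg hn0 (by linarith)
    gcongr
  have hVup : μH[d] V ≤ k2 * μH[d] ω := by
    rw [hV, ← setLIntegral_const]
    refine setLIntegral_mono' hωm ?_
    rintro _ ⟨y, hy, rfl⟩
    refine ENNReal.ofReal_le_ofReal ?_
    have h0 := hc1' y (hBA hy)
    have h1 := hc2' y (hBA hy)
    have h2 := (hf _ (hrads y)).2
    have hn0 : (0:ℝ) ≤ n := Nat.cast_nonneg n
    have h3 : 0 ≤ suppFn K (rad e y) ^ (p - 1) := hc1.le.trans h0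
    have h4 : 0 ≤ (n:ℝ) * τ2 := mul_nonneg hn0 (by linarith)
    gcongr
  have hω1 : μH[d] ω ≤ ((2 : ℝ≥0) : ℝ≥0∞) ^ d * μH[d] B :=
    (rad_lip e he).hausdorffMeasure_image_le hd0 B
  have hω2 : μH[d] B ≤ a * μH[d] ω := by
    refine anti_meas hd0 fun y hy y' hy' => ?_
    have := rad_anti e he y y' (hMA' y (hBA hy)) (hMA' y' (hBA hy'))
    rw [hL1]; push_cast at this ⊢; exact this
  have hS : (μH[d] : Measure (ℝ ∙ e)ᗮ) (subd (chartFn K x e) B) = μH[d] (projW e he '' V) := by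
    rw [subd_chart hKc hKcv hne x e he B]
    exact measure_preimage_add_right _ _ _
  have hplip : LipschitzWith 2 (projW e he) := by
    refine LipschitzWith.of_dist_le_mul fun z z' => ?_
    rw [dist_eq_norm, dist_eq_norm, projW_sub]
    exact projW_norm_le e he _
  have hP1 : μH[d] (projW e he '' V) ≤ ((2 : ℝ≥0) : ℝ≥0∞) ^ d * μH[d] V :=
    hplip.hausdorffMeasure_image_le hd0 V
  have hP2 : μH[d] V ≤ b * μH[d] (projW e he '' V) := by
    refine anti_meas hd0 fun z hz z' hz' => ?_
    simp only [hVdef, hω, mem_iUnion] at hz hz'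
    obtain ⟨_, ⟨y, hy, rfl⟩, hz⟩ := hz
    obtain ⟨_, ⟨y', hy', rfl⟩, hz'⟩ := hz'
    have := proj_anti hKc hne e he y y' (hMA y (hBA hy)) (hMA y' (hBA hy')) hz hz'
    push_cast; exact this
  rw [hS]
  have inv_le : ∀ {c X Y : ℝ≥0∞}, X ≤ c * Y → c⁻¹ * X ≤ Y := by
    intro c X Y h
    rw [mul_comm, ← div_eq_mul_inv]
    exact ENNReal.div_le_of_le_mul' h
  constructor
  · rw [mul_assoc, mul_assoc]
    refine inv_le (le_trans ?_ hP2)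
    refine le_trans ?_ hVlow
    gcongr
    exact inv_le hω2
  · calc _ ≤ ((2 : ℝ≥0) : ℝ≥0∞) ^ d * μH[d] V := hP1
      _ ≤ ((2 : ℝ≥0) : ℝ≥0∞) ^ d * (k2 * (((2 : ℝ≥0) : ℝ≥0∞) ^ d * μH[d] B)) := by
        gcongr; exact hVup.trans (by gcongr)
      _ = _ := by ring

lemma mem_normalCone_iff {K : Set EE} (hK : IsCompact K) {x : EE} (hx : x ∈ K) (u : EE) :
    u ∈ normalCone K x ↔ suppFn K u - ⟪x, u⟫ = 0 := by
  constructor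
  · intro h
    have h1 := suppFn_le ⟨x, hx⟩ h
    have h2 := le_suppFn hK u hx
    rw [real_inner_comm]; linarith
  · intro h y hy
    have := le_suppFn hK u hy
    rw [real_inner_comm] at h; linarith

end Concrete

/-- **Theorem 1.2 (ii).** If `o ∈ ∂K` is a smooth point, then `K` is smooth. -/
theorem stmt1 {n : ℕ} (hn : 2 ≤ n) {p : ℝ} (hp : p < 1) {τ1 τ2 : ℝ}
    (hτ1 : 0 < τ1) (hτ12 : τ1 < τ2) {f : EuclideanSpace ℝ (Fin n) → ℝ}
    (hf : ∀ u ∈ unitSphere n, τ1 < f u ∧ f u < τ2)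
    {K : Set (EuclideanSpace ℝ (Fin n))} (hK : IsConvexBody0 K)
    (hsol : IsLpSolution p f K)
    (ho : (0 : EuclideanSpace ℝ (Fin n)) ∈ frontier K)
    (hsm : IsSmoothPt K 0) :
    IsSmoothBody K := by
  obtain ⟨hKc, hKcv, ⟨k0, hk0⟩, h0K⟩ := id hK
  have hne : K.Nonempty := ⟨0, h0K⟩
  intro x hxf
  have hxK : x ∈ K := hKc.isClosed.frontier_subset hxf
  have hxi : x ∉ interior K := hxf.2
  obtain ⟨r, hr, hball⟩ := Metric.mem_nhds_iff.1 (mem_interior_iff_mem_nhds.1 hk0)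
  have hxk : x - k0 ≠ 0 := by
    intro h
    rw [sub_eq_zero] at h
    exact hxi (h ▸ hk0)
  have hxk0 : 0 < ‖x - k0‖ := norm_pos_iff.2 hxk
  obtain ⟨e, hedef⟩ : ∃ e, e = ‖x - k0‖⁻¹ • (x - k0) := ⟨_, rfl⟩
  have he : ‖e‖ = 1 := by
    rw [hedef, norm_smul, norm_inv, norm_norm, inv_mul_cancel₀ hxk0.ne']
  have hxe : x - k0 = ‖x - k0‖ • e := by
    rw [hedef, smul_smul, mul_inv_cancel₀ hxk0.ne', one_smul]
  -- lower bound of the support function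
  have hlow : ∀ u : EuclideanSpace ℝ (Fin n), ⟪k0, u⟫ + r / 2 * ‖u‖ ≤ suppFn K u := by
    intro u
    by_cases hu : u = 0
    · have := le_suppFn hKc u h0K
      simpa [hu] using this
    · have hu0 : 0 < ‖u‖ := norm_pos_iff.2 hu
      have hmem : k0 + (r / 2 * ‖u‖⁻¹) • u ∈ K := by
        apply hball
        rw [Metric.mem_ball, dist_eq_norm, add_sub_cancel_left, norm_smul, norm_mul, norm_inv,
          norm_norm, mul_assoc, inv_mul_cancel₀ hu0.ne', mul_one, Real.norm_eq_abs,
          abs_of_pos (by positivity)]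
        linarith
      have := le_suppFn hKc u hmem
      rw [inner_add_right, inner_smul_right, real_inner_self_eq_norm_sq, real_inner_comm] at this
      have e1 : r / 2 * ‖u‖⁻¹ * ‖u‖ ^ 2 = r / 2 * ‖u‖ := by field_simp
      linarith
  have hNpos : ∀ u ∈ normalCone K x, u ≠ 0 → 0 < ⟪e, u⟫ := by
    intro u hu hu0
    have h1 := (mem_normalCone_iff hKc hxK u).1 hu
    have h2 := hlow u
    have h3 : 0 < r / 2 * ‖u‖ := by
      have := norm_pos_iff.2 hu0
      positivity
    have h4 : 0 < ⟪x - k0, u⟫ := by rw [inner_sub_left]; linarith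
    rw [hxe, inner_smul_left, conj_trivial] at h4
    exact pos_of_mul_pos_right h4 hxk0.le
  -- chart points of the normal cone
  have hchart : ∀ u ∈ normalCone K x, u ≠ 0 → ∃ y : (ℝ ∙ e)ᗮ, chartFn K x e y = 0 ∧
      u = ⟪e, u⟫ • (e + (y : EuclideanSpace ℝ (Fin n))) := by
    intro u hu hu0
    have hp := hNpos u hu hu0
    refine ⟨⟪e, u⟫⁻¹ • projW e he u, ?_, ?_⟩
    · have hy : e + ((⟪e, u⟫⁻¹ • projW e he u : (ℝ ∙ e)ᗮ) : EuclideanSpace ℝ (Fin n)) =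
          ⟪e, u⟫⁻¹ • u := by
        rw [Submodule.coe_smul, coe_projW, smul_sub, smul_smul, inv_mul_cancel₀ hp.ne', one_smul]
        abel
      rw [chartFn, hy, suppFn_smul hKc hne (by positivity), inner_smul_right, ← mul_sub,
        (mem_normalCone_iff hKc hxK u).1 hu, mul_zero]
    · rw [Submodule.coe_smul, smul_add, smul_smul, mul_inv_cancel₀ hp.ne', one_smul, coe_projW]
      abel
  -- nonzero normal
  obtain ⟨u0, hu0N, hu0⟩ : ∃ u0 ∈ normalCone K x, u0 ≠ 0 := by
    obtain ⟨F, hF⟩ := geometric_hahn_banach_open_point hKcv.interior isOpen_interior hxi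
    have hfu : ∀ y, F y = ⟪(InnerProductSpace.toDual ℝ _).symm F, y⟫ := fun y => by
      rw [InnerProductSpace.toDual_symm_apply]
    refine ⟨(InnerProductSpace.toDual ℝ _).symm F, fun y hy => ?_, ?_⟩
    · rw [← hfu, ← hfu]
      have hcl : y ∈ closure (interior K) := by
        rw [hKcv.closure_interior_eq_closure_of_nonempty_interior ⟨k0, hk0⟩]
        exact subset_closure hy
      have : closure (interior K) ⊆ {y | F y ≤ F x} :=
        closure_minimal (fun y hy => (hF y hy).le) (isClosed_le F.continuous continuous_const)
      exact this hcl
    · intro h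
      have h1 := hF k0 hk0
      rw [hfu, hfu, h] at h1
      simp at h1
  obtain ⟨ya, hya, hua⟩ := hchart u0 hu0N hu0
  by_cases hall : ∀ y : (ℝ ∙ e)ᗮ, chartFn K x e y = 0 → y = ya
  · -- one-dimensional normal cone
    have hspan : Submodule.span ℝ (normalCone K x) = ℝ ∙ u0 := by
      apply le_antisymm
      · rw [Submodule.span_le]
        intro u hu
        by_cases hu' : u = 0
        · rw [hu']; exact Submodule.zero_mem _
        · obtain ⟨y, hy, huy⟩ := hchart u hu hu'
          rw [hall y hy] at huy
          refine Submodule.mem_span_singleton.2 ⟨⟪e, u⟫ * ⟪e, u0⟫⁻¹, ?_⟩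
          have hp := hNpos u0 hu0N hu0
          conv_lhs => rw [hua]
          rw [← hua, mul_smul]
          conv_rhs => rw [huy]
          congr 1
          conv_lhs => rw [hua]
          rw [← hua]
          nth_rewrite 2 [hua]
          rw [smul_smul, inv_mul_cancel₀ hp.ne', one_smul]
      · rw [Submodule.span_le]
        rintro _ rfl
        exact Submodule.subset_span hu0N
    rw [IsSmoothPt, hspan]
    exact finrank_span_singleton hu0
  · exfalso
    push Not at hall
    obtain ⟨yb, hyb, hyab⟩ := hall
    -- uniqueness of zeros of the support function
    have huniq : ∀ y y' : (ℝ ∙ e)ᗮ, suppFn K (e + (y : EuclideanSpace ℝ (Fin n))) ≤ 0 →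
        suppFn K (e + (y' : EuclideanSpace ℝ (Fin n))) ≤ 0 → y = y' := by
      intro y y' hy hy'
      have hN : ∀ y : (ℝ ∙ e)ᗮ, suppFn K (e + (y : EuclideanSpace ℝ (Fin n))) ≤ 0 →
          e + (y : EuclideanSpace ℝ (Fin n)) ∈ Submodule.span ℝ (normalCone K 0) := by
        intro y hy
        apply Submodule.subset_span
        intro z hz
        rw [inner_zero_right]
        exact (le_suppFn hKc _ hz).trans hy
      have hi : ∀ y : (ℝ ∙ e)ᗮ, ⟪e, e + (y : EuclideanSpace ℝ (Fin n))⟫ = 1 := by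
        intro y
        rw [inner_add_right, inner_e, real_inner_self_eq_norm_sq, he]; simp
      have hnz : (⟨_, hN y hy⟩ : Submodule.span ℝ (normalCone K 0)) ≠ 0 := by
        intro h
        have h1 : e + (y : EuclideanSpace ℝ (Fin n)) = 0 := congrArg Subtype.val h
        have h2 := hi y
        rw [h1, inner_zero_right] at h2
        norm_num at h2
      obtain ⟨c, hc⟩ := (finrank_eq_one_iff_of_nonzero' _ hnz).1 hsm ⟨_, hN y' hy'⟩
      have hc' : c • (e + (y : EuclideanSpace ℝ (Fin n))) = e + (y' : EuclideanSpace ℝ (Fin n)) :=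
        congrArg Subtype.val hc
      have h3 := hi y'
      rw [← hc', inner_smul_right, hi, mul_one] at h3
      rw [h3, one_smul] at hc'
      exact Subtype.ext (add_left_cancel hc')
    have hscont := suppFn_continuous hKc hne
    have hvcont : Continuous (chartFn K x e) := by
      unfold chartFn; fun_prop
    have hvconv : ConvexOn ℝ univ (chartFn K x e) := by
      refine ⟨convex_univ, fun a _ a' _ s t hs ht hst => ?_⟩
      have h1 : e + ((s • a + t • a' : (ℝ ∙ e)ᗮ) : EuclideanSpace ℝ (Fin n)) =
          s • (e + (a : EuclideanSpace ℝ (Fin n))) + t • (e + (a' : EuclideanSpace ℝ (Fin n))) := by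
        have : e = s • e + t • e := by rw [← add_smul, hst, one_smul]
        rw [Submodule.coe_add, Submodule.coe_smul, Submodule.coe_smul]
        nth_rewrite 1 [this]
        module
      have h2 := (suppFn_convex hKc hne).2 (mem_univ (e + (a : EuclideanSpace ℝ (Fin n))))
        (mem_univ (e + (a' : EuclideanSpace ℝ (Fin n)))) hs ht hst
      simp only [chartFn, smul_eq_mul] at h2 ⊢
      rw [h1, inner_add_right, inner_smul_right, inner_smul_right]
      linarith
    have hv0 : ∀ y, 0 ≤ chartFn K x e y := by
      intro y
      have := le_suppFn hKc (e + (y : EuclideanSpace ℝ (Fin n))) hxK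
      rw [real_inner_comm] at this
      rw [chartFn]; linarith
    have hcoer : ∀ y : (ℝ ∙ e)ᗮ, r / 2 * ‖y‖ - (‖x - k0‖ + r / 2) ≤ chartFn K x e y := by
      intro y
      have h1 := hlow (e + (y : EuclideanSpace ℝ (Fin n)))
      have h2 : ⟪x - k0, e + (y : EuclideanSpace ℝ (Fin n))⟫ = ‖x - k0‖ := by
        nth_rewrite 1 [hxe]
        rw [inner_smul_left, inner_add_right, inner_e, real_inner_self_eq_norm_sq, he]; simp
      rw [inner_sub_left] at h2
      have h3 : ‖y‖ ≤ ‖e + (y : EuclideanSpace ℝ (Fin n))‖ + 1 := by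
        have := norm_sub_le (e + (y : EuclideanSpace ℝ (Fin n))) e
        rw [add_sub_cancel_left, he] at this
        exact this
      have h4 : r / 2 * ‖y‖ ≤ r / 2 * (‖e + (y : EuclideanSpace ℝ (Fin n))‖ + 1) := by gcongr
      rw [chartFn]; linarith
    have hfin : (Module.finrank ℝ (ℝ ∙ e)ᗮ : ℝ) = (n : ℝ) - 1 := by
      have h1 := Submodule.finrank_add_finrank_orthogonal (ℝ ∙ e)
      have he0 : e ≠ 0 := by rw [← norm_pos_iff, he]; norm_num
      rw [finrank_span_singleton he0, finrank_euclideanSpace_fin] at h1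
      have : (1:ℝ) + (Module.finrank ℝ (ℝ ∙ e)ᗮ : ℝ) = n := by exact_mod_cast h1
      linarith
    have hhaar : (μH[(n : ℝ) - 1] : Measure (ℝ ∙ e)ᗮ).IsAddHaarMeasure := by
      rw [← hfin]; infer_instance
    have hUo : IsOpen {y : (ℝ ∙ e)ᗮ | 0 < suppFn K (e + (y : EuclideanSpace ℝ (Fin n)))} :=
      isOpen_lt continuous_const (by fun_prop)
    have hMA := transfer hn hτ1 hτ12 hf hK hsol x e he _ rfl
    by_cases hA : suppFn K (e + (ya : EuclideanSpace ℝ (Fin n))) ≤ 0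
    · refine abstract_main _ hvconv hvcont hv0 (half_pos hr) hcoer (y0 := ya) (y' := yb)
        hyab.symm hya hyb hUo (fun y hy hyne => ?_) hMA
      rw [mem_ofPred_eq]
      by_contra h
      exact hyne (huniq _ _ (not_lt.1 h) hA)
    · by_cases hB : ∃ yc, chartFn K x e yc = 0 ∧
          suppFn K (e + (yc : EuclideanSpace ℝ (Fin n))) ≤ 0
      · obtain ⟨yc, hyc, hyc0⟩ := hB
        refine abstract_main _ hvconv hvcont hv0 (half_pos hr) hcoer (y0 := yc) (y' := ya)
          ?_ hyc hya hUo (fun y hy hyne => ?_) hMA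
        · rintro rfl; exact hA hyc0
        · rw [mem_ofPred_eq]
          by_contra h
          exact hyne (huniq _ _ (not_lt.1 h) hyc0)
      · refine abstract_main _ hvconv hvcont hv0 (half_pos hr) hcoer (y0 := ya) (y' := yb)
          hyab.symm hya hyb hUo (fun y hy hyne => ?_) hMA
        rw [mem_ofPred_eq]
        by_contra h
        exact hB ⟨y, hy, not_lt.1 h⟩
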